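/- (Flow-Gaussian convolution inequality.) Let b satisfy hypothesis (H^b_0). For any T > 0 there exists ε = ε(T,κ₁,d) ∈ (0,1) such that for every λ > 0 there is a constant C = C(T,κ₁,d,λ) > 0 with ∫_{ℝ^d} 𝐠_λ(s,x,r,z)·𝐠_λ(r,z,t,y) dz ≤ C·𝐠_{ελ}(s,x,t,y) for all (s,t) ∈ 𝔻^T_0, all r ∈ (s,t) and all x,y ∈ ℝ^d. -/

import Mathlib

noncomputable section

open MeasureTheory Matrix Set

/-- The state space `ℝ^d`. -/
abbrev Vec (d : ℕ) := EuclideanSpace ℝ (Fin d)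

/-- Hypothesis (H^b_β): `b` is measurable, bounded at the origin uniformly in time
and Hölder/Lipschitz in space uniformly in time. -/
def HolderDrift (d : ℕ) (b : ℝ → Vec d → Vec d) (κ₁ β : ℝ) : Prop :=
  Measurable (Function.uncurry b) ∧
  (∀ t : ℝ, 0 ≤ t → ‖b t 0‖ ≤ κ₁) ∧
  (∀ t : ℝ, 0 ≤ t → ∀ x y : Vec d, ‖b t x - b t y‖ ≤ κ₁ * max (‖x - y‖ ^ β) ‖x - y‖)

/-- A smooth nonnegative mollifier supported in the closed unit ball with total mass one. -/
structure IsMollifier (d : ℕ) (ρ : Vec d → ℝ) : Prop where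
  smooth : ContDiff ℝ (⊤ : ℕ∞) ρ
  nonneg : ∀ x, 0 ≤ ρ x
  support_subset : Function.support ρ ⊆ Metric.closedBall 0 1
  integral_eq_one : ∫ x, ρ x = 1

/-- The spatially mollified drift `b_ε(t,x) = ∫ b(t,y) ρ_ε(x-y) dy`. -/
def mollifiedDrift (d : ℕ) (ρ : Vec d → ℝ) (ε : ℝ) (b : ℝ → Vec d → Vec d)
    (t : ℝ) (x : Vec d) : Vec d :=
  ∫ y : Vec d, (ε ^ (-(d : ℝ)) * ρ (ε⁻¹ • (x - y))) • b t y

/-- `θ` is the flow of the (time-dependent) vector field `f`: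
`θ t s x = x + ∫_s^t f(r, θ r s x) dr` for all nonnegative times. -/
def IsFlow (d : ℕ) (f : ℝ → Vec d → Vec d) (θ : ℝ → ℝ → Vec d → Vec d) : Prop :=
  ∀ s t : ℝ, 0 ≤ s → 0 ≤ t → ∀ x : Vec d,
    θ t s x = x + ∫ r in s..t, f r (θ r s x)

/-- The Gaussian kernel `g_λ(t,x) = t^{-d/2} exp(-λ |x|²/t)`. -/
def gaussk (d : ℕ) (l t : ℝ) (x : Vec d) : ℝ :=
  t ^ (-(d : ℝ) / 2) * Real.exp (-l * ‖x‖ ^ 2 / t)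

/-- A drift which is measurable, bounded at the origin uniformly in time, and Lipschitz in
space with constant `κ` uniformly in time. -/
def LipschitzDrift (d : ℕ) (b : ℝ → Vec d → Vec d) (κ : ℝ) : Prop :=
  Measurable (Function.uncurry b) ∧
  (∃ M : ℝ, ∀ t : ℝ, 0 ≤ t → ‖b t 0‖ ≤ M) ∧
  (∀ t : ℝ, 0 ≤ t → ∀ x y : Vec d, ‖b t x - b t y‖ ≤ κ * ‖x - y‖)

/-- Integral form of Grönwall's inequality. -/
lemma le_mul_exp_of_le_add_integral {φ : ℝ → ℝ} {a b c L : ℝ} (hL : 0 ≤ L)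
    (hφ : ContinuousOn φ (Icc a b))
    (h : ∀ τ ∈ Icc a b, φ τ ≤ c + L * ∫ r in a..τ, φ r) :
    ∀ τ ∈ Icc a b, φ τ ≤ c * Real.exp (L * (τ - a)) := by
  intro τ hτ
  have hab : a ≤ b := hτ.1.trans hτ.2
  set ψ : ℝ → ℝ := IccExtend hab ((Icc a b).domRestrict φ) with hψ
  have hψc : Continuous ψ := (continuousOn_iff_continuous_domRestrict.1 hφ).Icc_extend'
  have hψφ : ∀ x ∈ Icc a b, ψ x = φ x := fun x hx => by
    rw [hψ, IccExtend_of_mem hab _ hx, domRestrict_apply]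
  have hint : ∀ x ∈ Icc a b, ∫ r in a..x, φ r = ∫ r in a..x, ψ r := fun x hx => by
    refine intervalIntegral.integral_congr fun r hr => (hψφ r ?_).symm
    rw [uIcc_of_le hx.1] at hr
    exact ⟨hr.1, hr.2.trans hx.2⟩
  set G : ℝ → ℝ := fun x => c + L * ∫ r in a..x, ψ r with hG
  have hGd : ∀ x, HasDerivAt G (L * ψ x) x := fun x =>
    ((intervalIntegral.integral_hasDerivAt_right (hψc.intervalIntegrable _ _)
      (hψc.stronglyMeasurableAtFilter _ _) hψc.continuousAt).const_mul L).const_add c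
  have hφG : ∀ x ∈ Icc a b, φ x ≤ G x := fun x hx => by
    have := h x hx
    rwa [hint x hx] at this
  have hgr := le_gronwallBound_of_liminf_deriv_right_le (f := G) (f' := fun x => L * ψ x)
    (δ := c) (K := L) (ε := 0) (a := a) (b := b)
    (fun x _ => (hGd x).continuousAt.continuousWithinAt)
    (fun x _ r hr => (hGd x).hasDerivWithinAt.liminf_right_slope_le hr)
    (by simp [hG])
    (fun x hx => by
      have hx' : x ∈ Icc a b := ⟨hx.1, hx.2.le⟩
      rw [add_zero, hψφ x hx']
      exact mul_le_mul_of_nonneg_left (hφG x hx') hL) τ hτ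
  rw [gronwallBound_ε0] at hgr
  exact (hφG τ hτ).trans hgr

/-- `u` solves `u t = x + ∫_s^t f(r, u r) dr` for all `t ≥ s`. -/
def IsForwardSolution {d : ℕ} (f : ℝ → Vec d → Vec d) (s : ℝ) (x : Vec d) (u : ℝ → Vec d) :
    Prop :=
  ∀ t, s ≤ t → u t = x + ∫ r in s..t, f r (u r)

lemma LipschitzDrift.exists_growth {d : ℕ} {f : ℝ → Vec d → Vec d} {L : ℝ}
    (hf : LipschitzDrift d f L) :
    ∃ M : ℝ, ∀ t, 0 ≤ t → ∀ x, ‖f t x‖ ≤ M + L * ‖x‖ := by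
  obtain ⟨M, hM⟩ := hf.2.1
  refine ⟨M, fun t ht x => ?_⟩
  have h1 := hf.2.2 t ht x 0
  rw [sub_zero] at h1
  linarith [hM t ht, norm_sub_norm_le (f t x) (f t 0)]

lemma IsForwardSolution.continuousOn {d : ℕ} {f : ℝ → Vec d → Vec d} {s t : ℝ} {x : Vec d}
    {u : ℝ → Vec d} (hu : IsForwardSolution f s x u)
    (hi : IntegrableOn (fun r => f r (u r)) (Icc s t)) : ContinuousOn u (Icc s t) := by
  rcases lt_or_ge t s with h | hst
  · simp [Icc_eq_empty_of_lt h]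
  have h := intervalIntegral.continuousOn_primitive_interval (μ := volume) (a := s) (b := t)
    (f := fun r => f r (u r)) (by rwa [uIcc_of_le hst])
  rw [uIcc_of_le hst] at h
  exact (continuousOn_const.add h).congr fun τ hτ => hu τ hτ.1

lemma IsForwardSolution.norm_le {d : ℕ} {f : ℝ → Vec d → Vec d} {s t : ℝ} {x : Vec d}
    {u : ℝ → Vec d} {L M : ℝ} (hL : 0 ≤ L) (hs : 0 ≤ s)
    (hM : ∀ t, 0 ≤ t → ∀ x, ‖f t x‖ ≤ M + L * ‖x‖) (hu : IsForwardSolution f s x u)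
    (hi : IntegrableOn (fun r => f r (u r)) (Icc s t)) :
    ∀ τ ∈ Icc s t, ‖f τ (u τ)‖ ≤ (M + L * ‖x‖) * Real.exp (L * (τ - s)) := by
  intro τ hτ
  refine (hM τ (hs.trans hτ.1) _).trans ?_
  have hc := hu.continuousOn hi
  have hψ : ContinuousOn (fun r => M + L * ‖u r‖) (Icc s t) :=
    continuousOn_const.add (continuousOn_const.mul hc.norm)
  refine le_mul_exp_of_le_add_integral (φ := fun r => M + L * ‖u r‖) hL hψ
    (fun σ hσ => ?_) τ hτ
  have hsub : Icc s σ ⊆ Icc s t := Icc_subset_Icc_right hσ.2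
  have h1 : ‖∫ r in s..σ, f r (u r)‖ ≤ ∫ r in s..σ, (M + L * ‖u r‖) := by
    refine intervalIntegral.norm_integral_le_of_norm_le hσ.1
      (Filter.Eventually.of_forall fun r hr => hM r (hs.trans hr.1.le) _) ?_
    exact ContinuousOn.intervalIntegrable_of_Icc hσ.1 (hψ.mono hsub)
  have h2 : ‖u σ‖ ≤ ‖x‖ + ∫ r in s..σ, (M + L * ‖u r‖) := by
    rw [hu σ hσ.1]
    exact (norm_add_le _ _).trans (by gcongr)
  have := mul_le_mul_of_nonneg_left h2 hL
  linarith

/-- A forward solution for a Lipschitz drift has an integrable velocity: if integrability were to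
fail, the solution would be frozen at `x` (the Bochner integral being zero), hence bounded. -/
lemma IsForwardSolution.integrableOn {d : ℕ} {f : ℝ → Vec d → Vec d} {s : ℝ} {x : Vec d}
    {u : ℝ → Vec d} {L : ℝ} (hL : 0 ≤ L) (hs : 0 ≤ s) (hf : LipschitzDrift d f L)
    (hu : IsForwardSolution f s x u) (t : ℝ) :
    IntegrableOn (fun r => f r (u r)) (Icc s t) := by
  by_contra hn
  obtain ⟨M, hM⟩ := hf.exists_growth
  have hst : s < t := by
    by_contra! h
    refine hn (IntegrableOn.mono_set ?_ (Icc_subset_Icc_right h))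
    simp
  set F : ℝ → Vec d := fun r => f r (u r) with hF
  set A : Set ℝ := {τ | s ≤ τ ∧ IntegrableOn F (Icc s τ)} with hA
  have hsA : s ∈ A := ⟨le_rfl, by simp⟩
  have hAt : ∀ τ ∈ A, τ ≤ t := fun τ hτ => by
    by_contra! h
    exact hn (hτ.2.mono_set (Icc_subset_Icc_right h.le))
  have hbdd : BddAbove A := ⟨t, hAt⟩
  set T := sSup A with hT
  have hsT : s ≤ T := le_csSup hbdd hsA
  have hTt : T ≤ t := csSup_le ⟨s, hsA⟩ hAt
  obtain ⟨v, -, hvT, hvA⟩ := exists_seq_tendsto_sSup ⟨s, hsA⟩ hbdd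
  have hpos : 0 ≤ M + L * ‖x‖ := (norm_nonneg _).trans (hM s hs x)
  have hleft : IntegrableOn F (Ioc s T) := by
    refine integrableOn_Ioc_of_intervalIntegral_norm_bounded_right (l := Filter.atTop) (b := v)
      (I := (M + L * ‖x‖) * Real.exp (L * (t - s)) * (t - s))
      (fun i => (hvA i).2.mono_set Ioc_subset_Icc_self) hvT (Filter.Eventually.of_forall fun i => ?_)
    have hvs : s ≤ v i := (hvA i).1
    have hvt : v i ≤ t := hAt _ (hvA i)
    have hb := hu.norm_le hL hs hM (hvA i).2
    rw [← intervalIntegral.integral_of_le hvs]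
    have h1 : ∫ r in s..v i, ‖F r‖ ≤
        ∫ r in s..v i, (M + L * ‖x‖) * Real.exp (L * (t - s)) := by
      refine intervalIntegral.integral_mono_on hvs ?_ (by simp) fun r hr => ?_
      · rw [intervalIntegrable_iff_integrableOn_Icc_of_le hvs]
        exact (hvA i).2.norm
      · refine (hb r hr).trans ?_
        gcongr
        exact hr.2.trans hvt
    refine h1.trans ?_
    rw [intervalIntegral.integral_const, smul_eq_mul, mul_comm]
    gcongr
  have hright : IntegrableOn F (Ioc T t) := by
    have hux : ∀ r ∈ Ioc T t, F r = f r x := fun r hr => by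
      have hrs : s ≤ r := hsT.trans hr.1.le
      have hrA : ¬ IntervalIntegrable F volume s r := fun h => by
        rw [intervalIntegrable_iff_integrableOn_Icc_of_le hrs] at h
        exact absurd (le_csSup hbdd (show r ∈ A from ⟨hrs, h⟩)) (not_le.2 hr.1)
      have := hu r hrs
      rw [intervalIntegral.integral_undef hrA, add_zero] at this
      simp only [hF, this]
    have hconst : IntegrableOn (fun r => f r x) (Ioc T t) := by
      refine IntegrableOn.of_bound (by simp)
        (hf.1.comp (measurable_id.prodMk measurable_const)).aestronglyMeasurable (M + L * ‖x‖) ?_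
      refine (ae_restrict_iff' measurableSet_Ioc).2 (Filter.Eventually.of_forall fun r hr => ?_)
      exact hM r (hs.trans (hsT.trans hr.1.le)) x
    exact hconst.congr_fun (fun r hr => (hux r hr).symm) measurableSet_Ioc
  refine hn ?_
  rw [integrableOn_Icc_iff_integrableOn_Ioc, ← Ioc_union_Ioc_eq_Ioc hsT hTt]
  exact hleft.union hright

lemma IsForwardSolution.norm_sub_le {d : ℕ} {f : ℝ → Vec d → Vec d} {s t : ℝ} {x y : Vec d}
    {u v : ℝ → Vec d} {L : ℝ} (hL : 0 ≤ L) (hs : 0 ≤ s) (hf : LipschitzDrift d f L)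
    (hu : IsForwardSolution f s x u) (hv : IsForwardSolution f s y v) (hst : s ≤ t) :
    ‖u t - v t‖ ≤ ‖x - y‖ * Real.exp (L * (t - s)) ∧
      ‖x - y‖ ≤ ‖u t - v t‖ * Real.exp (L * (t - s)) := by
  have hui := hu.integrableOn hL hs hf t
  have hvi := hv.integrableOn hL hs hf t
  have hw : ContinuousOn (fun r => ‖u r - v r‖) (Icc s t) :=
    ((hu.continuousOn hui).sub (hv.continuousOn hvi)).norm
  have hii : ∀ {F : ℝ → Vec d}, IntegrableOn F (Icc s t) → ∀ a ∈ Icc s t, ∀ b ∈ Icc s t,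
      IntervalIntegrable F volume a b := fun hF a ha b hb =>
    (hF.mono_set (ordConnected_Icc.uIcc_subset ha hb)).intervalIntegrable
  have hsm : s ∈ Icc s t := ⟨le_rfl, hst⟩
  have htm : t ∈ Icc s t := ⟨hst, le_rfl⟩
  have key : ∀ a ∈ Icc s t, ∀ b ∈ Icc s t, a ≤ b →
      (u b - v b) - (u a - v a) = ∫ r in a..b, (f r (u r) - f r (v r)) ∧
      ‖∫ r in a..b, (f r (u r) - f r (v r))‖ ≤ L * ∫ r in a..b, ‖u r - v r‖ := by
    intro a ha b hb hab
    constructor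
    · rw [intervalIntegral.integral_sub (hii hui a ha b hb) (hii hvi a ha b hb), hu b hb.1,
        hu a ha.1, hv b hb.1, hv a ha.1,
        ← intervalIntegral.integral_add_adjacent_intervals (hii hui s hsm a ha)
          (hii hui a ha b hb),
        ← intervalIntegral.integral_add_adjacent_intervals (hii hvi s hsm a ha)
          (hii hvi a ha b hb)]
      abel
    · rw [← intervalIntegral.integral_const_mul]
      refine intervalIntegral.norm_integral_le_of_norm_le hab
        (Filter.Eventually.of_forall fun r hr =>
          hf.2.2 r (hs.trans (ha.1.trans hr.1.le)) _ _) ?_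
      exact ContinuousOn.intervalIntegrable_of_Icc hab
        (continuousOn_const.mul (hw.mono (Icc_subset_Icc ha.1 hb.2)))
  have hus : u s = x := by simpa using hu s le_rfl
  have hvs : v s = y := by simpa using hv s le_rfl
  constructor
  · refine le_mul_exp_of_le_add_integral (φ := fun r => ‖u r - v r‖) hL hw (fun τ hτ => ?_) t htm
    obtain ⟨h1, h2⟩ := key s hsm τ hτ hτ.1
    rw [← h1, hus, hvs] at h2
    linarith [norm_sub_norm_le (u τ - v τ) (x - y)]
  · have hmaps : MapsTo (fun r : ℝ => -r) (Icc (-t) (-s)) (Icc s t) := fun r hr =>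
      ⟨by linarith [hr.2], by linarith [hr.1]⟩
    have := le_mul_exp_of_le_add_integral (φ := fun r => ‖u (-r) - v (-r)‖) (a := -t) (b := -s)
      (c := ‖u t - v t‖) hL (hw.comp continuous_neg.continuousOn hmaps) (fun τ hτ => ?_) (-s)
      ⟨by linarith, le_rfl⟩
    · simp only [neg_neg, hus, hvs] at this
      rwa [show -s - -t = t - s by ring] at this
    · obtain ⟨h1, h2⟩ := key (-τ) (hmaps hτ) t htm (hmaps hτ).2
      rw [← h1] at h2
      rw [intervalIntegral.integral_comp_neg (fun r => ‖u r - v r‖), neg_neg]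
      linarith [norm_sub_norm_le (u (-τ) - v (-τ)) (u t - v t),
        norm_sub_rev (u t - v t) (u (-τ) - v (-τ))]

lemma IsForwardSolution.restart {d : ℕ} {f : ℝ → Vec d → Vec d} {s r : ℝ} {x : Vec d}
    {u : ℝ → Vec d} {L : ℝ} (hL : 0 ≤ L) (hs : 0 ≤ s) (hf : LipschitzDrift d f L)
    (hu : IsForwardSolution f s x u) (hsr : s ≤ r) : IsForwardSolution f r (u r) u := by
  intro t hrt
  have hi : ∀ a b, s ≤ a → s ≤ b → IntervalIntegrable (fun r => f r (u r)) volume a b :=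
    fun a b ha hb => ((hu.integrableOn hL hs hf (max a b)).mono_set
      (Icc_subset_Icc_left (le_min ha hb))).intervalIntegrable
  rw [hu t (hsr.trans hrt), hu r hsr, add_assoc,
    intervalIntegral.integral_add_adjacent_intervals (hi s r le_rfl hsr)
      (hi r t hsr (hsr.trans hrt))]

lemma IsFlow.isForwardSolution {d : ℕ} {f : ℝ → Vec d → Vec d} {θ : ℝ → ℝ → Vec d → Vec d}
    (hθ : IsFlow d f θ) {s : ℝ} (hs : 0 ≤ s) (x : Vec d) :
    IsForwardSolution f s x (fun t => θ t s x) :=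
  fun t hst => hθ s t hs (hs.trans hst) x

lemma IsFlow.comp_apply {d : ℕ} {f : ℝ → Vec d → Vec d} {θ : ℝ → ℝ → Vec d → Vec d} {L : ℝ}
    (hL : 0 ≤ L) (hf : LipschitzDrift d f L) (hθ : IsFlow d f θ) {s r t : ℝ} (hs : 0 ≤ s)
    (hsr : s ≤ r) (hrt : r ≤ t) (x : Vec d) : θ t r (θ r s x) = θ t s x := by
  have h := ((hθ.isForwardSolution (hs.trans hsr) (θ r s x)).norm_sub_le hL (hs.trans hsr) hf
    ((hθ.isForwardSolution hs x).restart hL hs hf hsr) hrt).1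
  simpa [sub_eq_zero] using h

lemma IsMollifier.hasCompactSupport {d : ℕ} {ρ : Vec d → ℝ} (hρ : IsMollifier d ρ) :
    HasCompactSupport ρ :=
  HasCompactSupport.of_support_subset_isCompact (isCompact_closedBall 0 1) hρ.support_subset

lemma IsMollifier.eq_zero_of_one_lt_norm {d : ℕ} {ρ : Vec d → ℝ} (hρ : IsMollifier d ρ)
    {x : Vec d} (hx : 1 < ‖x‖) : ρ x = 0 := by
  by_contra h
  have := hρ.support_subset h
  rw [mem_closedBall_zero_iff] at this
  linarith

lemma HolderDrift.norm_sub_le {d : ℕ} {b : ℝ → Vec d → Vec d} {κ₁ : ℝ}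
    (hb : HolderDrift d b κ₁ 0) {t : ℝ} (ht : 0 ≤ t) (x y : Vec d) :
    ‖b t x - b t y‖ ≤ κ₁ * max 1 ‖x - y‖ := by
  simpa using hb.2.2 t ht x y

lemma HolderDrift.norm_le {d : ℕ} {b : ℝ → Vec d → Vec d} {κ₁ : ℝ} (hκ₁ : 0 < κ₁)
    (hb : HolderDrift d b κ₁ 0) {t : ℝ} (ht : 0 ≤ t) (x : Vec d) :
    ‖b t x‖ ≤ κ₁ * (2 + ‖x‖) := by
  have h1 := hb.norm_sub_le ht x 0
  rw [sub_zero] at h1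
  have h2 : κ₁ * max 1 ‖x‖ ≤ κ₁ * (1 + ‖x‖) := by
    gcongr
    exact max_le (by linarith [norm_nonneg x]) (by linarith)
  linarith [hb.2.1 t ht, norm_sub_norm_le (b t x) (b t 0)]

lemma mollifiedDrift_one {d : ℕ} (ρ : Vec d → ℝ) (b : ℝ → Vec d → Vec d) (t : ℝ) (x : Vec d) :
    mollifiedDrift d ρ 1 b t x = ∫ y, ρ (x - y) • b t y := by
  simp [mollifiedDrift]

lemma mollifiedDrift_one' {d : ℕ} (ρ : Vec d → ℝ) (b : ℝ → Vec d → Vec d) (t : ℝ) (x : Vec d) :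
    mollifiedDrift d ρ 1 b t x = ∫ y, ρ y • b t (x - y) := by
  rw [mollifiedDrift_one, ← integral_sub_left_eq_self (fun y => ρ (x - y) • b t y) volume x]
  simp

lemma IsMollifier.integrable {d : ℕ} {ρ : Vec d → ℝ} (hρ : IsMollifier d ρ) : Integrable ρ :=
  hρ.smooth.continuous.integrable_of_hasCompactSupport hρ.hasCompactSupport

lemma HolderDrift.integrable_mollifier_smul {d : ℕ} {ρ : Vec d → ℝ} (hρ : IsMollifier d ρ)
    {b : ℝ → Vec d → Vec d} {κ₁ : ℝ} (hκ₁ : 0 < κ₁) (hb : HolderDrift d b κ₁ 0) {t : ℝ}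
    (ht : 0 ≤ t) (x : Vec d) : Integrable (fun y => ρ y • b t (x - y)) := by
  have hg : Integrable (fun y => ρ y * (κ₁ * (2 + ‖x - y‖))) := by
    refine Continuous.integrable_of_hasCompactSupport ?_ hρ.hasCompactSupport.mul_right
    have := hρ.smooth.continuous
    fun_prop
  refine hg.mono' ?_ (Filter.Eventually.of_forall fun y => ?_)
  · have h1 : Measurable (fun y => b t (x - y)) :=
      hb.1.comp (measurable_const.prodMk (measurable_const.sub measurable_id))
    exact (hρ.smooth.continuous.measurable.smul h1).aestronglyMeasurable
  · rw [norm_smul, Real.norm_of_nonneg (hρ.nonneg y)]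
    exact mul_le_mul_of_nonneg_left (hb.norm_le hκ₁ ht _) (hρ.nonneg y)

lemma HolderDrift.integrable_mollifier_sub_smul {d : ℕ} {ρ : Vec d → ℝ} (hρ : IsMollifier d ρ)
    {b : ℝ → Vec d → Vec d} {κ₁ : ℝ} (hκ₁ : 0 < κ₁) (hb : HolderDrift d b κ₁ 0) {t : ℝ}
    (ht : 0 ≤ t) (x : Vec d) : Integrable (fun y => ρ (x - y) • b t y) := by
  simpa using (hb.integrable_mollifier_smul hρ hκ₁ ht x).comp_sub_left x

lemma measurable_mollifiedDrift_one {d : ℕ} {ρ : Vec d → ℝ} (hρ : IsMollifier d ρ)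
    {b : ℝ → Vec d → Vec d} (hb : Measurable (Function.uncurry b)) :
    Measurable (Function.uncurry (mollifiedDrift d ρ 1 b)) := by
  have h : Measurable (fun q : (ℝ × Vec d) × Vec d => ρ (q.1.2 - q.2) • b q.1.1 q.2) := by
    refine Measurable.smul (hρ.smooth.continuous.measurable.comp ?_) ?_
    · fun_prop
    · exact hb.comp (measurable_fst.fst.prodMk measurable_snd)
  have h2 := (h.stronglyMeasurable.integral_prod_right' (ν := (volume : Measure (Vec d)))).measurable
  convert h2 using 1
  ext1 p
  exact mollifiedDrift_one ρ b p.1 p.2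

lemma HolderDrift.norm_mollifiedDrift_sub_le_of_one_le {d : ℕ} {ρ : Vec d → ℝ}
    (hρ : IsMollifier d ρ) {b : ℝ → Vec d → Vec d} {κ₁ : ℝ} (hκ₁ : 0 < κ₁)
    (hb : HolderDrift d b κ₁ 0) {t : ℝ} (ht : 0 ≤ t) {x y : Vec d} (hxy : 1 ≤ ‖x - y‖) :
    ‖mollifiedDrift d ρ 1 b t x - mollifiedDrift d ρ 1 b t y‖ ≤ κ₁ * ‖x - y‖ := by
  rw [mollifiedDrift_one', mollifiedDrift_one', ← integral_sub
    (hb.integrable_mollifier_smul hρ hκ₁ ht x) (hb.integrable_mollifier_smul hρ hκ₁ ht y)]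
  have h : ∫ z, ρ z * (κ₁ * ‖x - y‖) = κ₁ * ‖x - y‖ := by
    rw [integral_mul_const, hρ.integral_eq_one, one_mul]
  rw [← h]
  refine norm_integral_le_of_norm_le (hρ.integrable.mul_const _)
    (Filter.Eventually.of_forall fun z => ?_)
  rw [← smul_sub, norm_smul, Real.norm_of_nonneg (hρ.nonneg z)]
  refine mul_le_mul_of_nonneg_left ?_ (hρ.nonneg z)
  have := hb.norm_sub_le ht (x - z) (y - z)
  rwa [sub_sub_sub_cancel_right, max_eq_right hxy] at this

lemma HolderDrift.norm_mollifiedDrift_sub_le_of_le_one {d : ℕ} {ρ : Vec d → ℝ}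
    (hρ : IsMollifier d ρ) {K : NNReal} (hK : LipschitzWith K ρ)
    {b : ℝ → Vec d → Vec d} {κ₁ : ℝ} (hκ₁ : 0 < κ₁)
    (hb : HolderDrift d b κ₁ 0) {t : ℝ} (ht : 0 ≤ t) {x y : Vec d} (hxy : ‖x - y‖ ≤ 1) :
    ‖mollifiedDrift d ρ 1 b t x - mollifiedDrift d ρ 1 b t y‖ ≤
      volume.real (Metric.closedBall (0 : Vec d) 2) * (K * (κ₁ * 2)) * ‖x - y‖ := by
  have hix := hρ.integrable.comp_sub_left x
  have hiy := hρ.integrable.comp_sub_left y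
  have hzero : ∫ z, (ρ (x - z) - ρ (y - z)) • b t x = 0 := by
    rw [integral_smul_const, integral_sub hix hiy, integral_sub_left_eq_self ρ volume x,
      integral_sub_left_eq_self ρ volume y, sub_self, zero_smul]
  have hrepr : mollifiedDrift d ρ 1 b t x - mollifiedDrift d ρ 1 b t y =
      ∫ z, (ρ (x - z) - ρ (y - z)) • (b t z - b t x) := by
    have hi := (hb.integrable_mollifier_sub_smul hρ hκ₁ ht x).sub
      (hb.integrable_mollifier_sub_smul hρ hκ₁ ht y)
    have h := integral_sub hi ((hix.sub hiy).smul_const (b t x))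
    simp only [Pi.sub_apply] at h
    rw [hzero, sub_zero, integral_sub (hb.integrable_mollifier_sub_smul hρ hκ₁ ht x)
      (hb.integrable_mollifier_sub_smul hρ hκ₁ ht y)] at h
    rw [mollifiedDrift_one, mollifiedDrift_one, ← h]
    simp only [smul_sub, sub_smul]
  have hfin : volume (Metric.closedBall x 2) ≠ ⊤ := measure_closedBall_lt_top.ne
  have hval : ∫ z, (Metric.closedBall x 2).indicator (fun _ => K * ‖x - y‖ * (κ₁ * 2)) z =
      volume.real (Metric.closedBall (0 : Vec d) 2) * (K * (κ₁ * 2)) * ‖x - y‖ := by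
    rw [integral_indicator_const _ Metric.isClosed_closedBall.measurableSet, smul_eq_mul,
      Measure.real, Measure.real, Measure.addHaar_closedBall_center]
    ring
  rw [hrepr, ← hval]
  refine norm_integral_le_of_norm_le ((integrable_indicator_iff
    Metric.isClosed_closedBall.measurableSet).2 (integrableOn_const hfin))
    (Filter.Eventually.of_forall fun z => ?_)
  rw [norm_smul]
  by_cases hz : z ∈ Metric.closedBall x 2
  · rw [indicator_of_mem hz]
    have h1 : ‖ρ (x - z) - ρ (y - z)‖ ≤ K * ‖x - y‖ := by
      simpa using hK.norm_sub_le (x - z) (y - z)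
    have h2 : ‖b t z - b t x‖ ≤ κ₁ * 2 := by
      refine (hb.norm_sub_le ht z x).trans ?_
      gcongr
      exact max_le (by norm_num) (mem_closedBall_iff_norm.1 hz)
    gcongr
  · rw [indicator_of_notMem hz]
    rw [mem_closedBall_iff_norm, not_le, norm_sub_rev] at hz
    have h1 : 1 < ‖y - z‖ := by
      have := norm_sub_norm_le (x - z) (x - y)
      rw [sub_sub_sub_cancel_left] at this
      linarith
    rw [hρ.eq_zero_of_one_lt_norm (by linarith), hρ.eq_zero_of_one_lt_norm h1]
    simp

/-- Mollification at unit scale turns a drift satisfying (H^b_0) into a Lipschitz drift, with a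
constant depending only on `κ₁` and the mollifier. -/
lemma IsMollifier.exists_lipschitzDrift {d : ℕ} {ρ : Vec d → ℝ} (hρ : IsMollifier d ρ) {κ₁ : ℝ}
    (hκ₁ : 0 < κ₁) : ∃ L : ℝ, 0 ≤ L ∧ ∀ b : ℝ → Vec d → Vec d, HolderDrift d b κ₁ 0 →
      LipschitzDrift d (mollifiedDrift d ρ 1 b) L := by
  obtain ⟨K, hK⟩ := hρ.smooth.lipschitzWith_of_hasCompactSupport hρ.hasCompactSupport (by simp)
  refine ⟨max κ₁ (volume.real (Metric.closedBall (0 : Vec d) 2) * (K * (κ₁ * 2))),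
    hκ₁.le.trans (le_max_left _ _), fun b hb => ⟨measurable_mollifiedDrift_one hρ hb.1,
      ⟨κ₁ * 3, fun t ht => ?_⟩, fun t ht x y => ?_⟩⟩
  · have h : ∫ z, ρ z * (κ₁ * 3) = κ₁ * 3 := by
      rw [integral_mul_const, hρ.integral_eq_one, one_mul]
    rw [mollifiedDrift_one', ← h]
    refine norm_integral_le_of_norm_le (hρ.integrable.mul_const _)
      (Filter.Eventually.of_forall fun z => ?_)
    rw [norm_smul, Real.norm_of_nonneg (hρ.nonneg z)]
    by_cases hz : 1 < ‖z‖
    · simp [hρ.eq_zero_of_one_lt_norm hz]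
    · refine mul_le_mul_of_nonneg_left ((hb.norm_le hκ₁ ht _).trans ?_) (hρ.nonneg z)
      rw [zero_sub, norm_neg]
      gcongr
      linarith
  · rcases le_total 1 ‖x - y‖ with h | h
    · exact (hb.norm_mollifiedDrift_sub_le_of_one_le hρ hκ₁ ht h).trans
        (by gcongr; exact le_max_left _ _)
    · exact (hb.norm_mollifiedDrift_sub_le_of_le_one hρ hK hκ₁ ht h).trans
        (by gcongr; exact le_max_right _ _)

lemma integrable_exp_neg_mul_sq_norm_sub {d : ℕ} {c : ℝ} (hc : 0 < c) (z₀ : Vec d) :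
    Integrable (fun z : Vec d => Real.exp (-c * ‖z - z₀‖ ^ 2)) ∧
      ∫ z : Vec d, Real.exp (-c * ‖z - z₀‖ ^ 2) = (Real.pi / c) ^ ((d : ℝ) / 2) := by
  have h := GaussianFourier.integral_rexp_neg_mul_sq_norm (V := Vec d) hc
  rw [finrank_euclideanSpace_fin] at h
  have hi : Integrable (fun z : Vec d => Real.exp (-c * ‖z‖ ^ 2)) := by
    refine Integrable.of_integral_ne_zero ?_
    rw [h]
    have := Real.pi_pos
    positivity
  exact ⟨hi.comp_sub_right z₀, by rw [← h, integral_sub_right_eq_self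
    (fun z : Vec d => Real.exp (-c * ‖z‖ ^ 2))]⟩

lemma gaussk_nonneg (d : ℕ) (l : ℝ) {t : ℝ} (ht : 0 ≤ t) (x : Vec d) : 0 ≤ gaussk d l t x :=
  mul_nonneg (Real.rpow_nonneg ht _) (Real.exp_pos _).le

/-- If the integrand is dominated by a Gaussian centred at `z₀` of variance scale `ν ≤ μ`, up to the
factor `exp (-q)`, its integral has the expected size `(μ + ν)^(-d/2) exp (-q)`. -/
lemma integral_le_of_le_gaussian {d : ℕ} {c q m μ ν : ℝ} (hc : 0 < c) (hν : 0 < ν)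
    (hνμ : ν ≤ μ) {G : Vec d → ℝ} (hG : ∀ z, 0 ≤ G z) (z₀ : Vec d)
    (h : ∀ z, G z ≤ μ ^ (-(d : ℝ) / 2) * ν ^ (-(d : ℝ) / 2) *
      (Real.exp m * Real.exp (-q) * Real.exp (-(c / ν) * ‖z - z₀‖ ^ 2))) :
    ∫ z, G z ≤ Real.exp m * 2 ^ ((d : ℝ) / 2) * (Real.pi / c) ^ ((d : ℝ) / 2) *
      ((μ + ν) ^ (-(d : ℝ) / 2) * Real.exp (-q)) := by
  have hμ : 0 < μ := hν.trans_le hνμ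
  have hπ := Real.pi_pos
  obtain ⟨hi, hv⟩ := integrable_exp_neg_mul_sq_norm_sub (d := d) (div_pos hc hν) z₀
  have h1 : ∫ z, G z ≤ ∫ z, μ ^ (-(d : ℝ) / 2) * ν ^ (-(d : ℝ) / 2) *
      (Real.exp m * Real.exp (-q) * Real.exp (-(c / ν) * ‖z - z₀‖ ^ 2)) :=
    integral_mono_of_nonneg (Filter.Eventually.of_forall hG)
      ((hi.const_mul _).const_mul _) (Filter.Eventually.of_forall h)
  refine h1.trans ?_
  rw [integral_const_mul, integral_const_mul, hv]
  have h2 : μ ^ (-(d : ℝ) / 2) ≤ 2 ^ ((d : ℝ) / 2) * (μ + ν) ^ (-(d : ℝ) / 2) := by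
    have h3 : μ ^ (-(d : ℝ) / 2) ≤ ((μ + ν) / 2) ^ (-(d : ℝ) / 2) := by
      refine Real.rpow_le_rpow_of_nonpos (by positivity) (by linarith) ?_
      have : (0 : ℝ) ≤ d := Nat.cast_nonneg d
      linarith
    rw [Real.div_rpow (by positivity) (by norm_num), neg_div,
      Real.rpow_neg (by norm_num : (0 : ℝ) ≤ 2), div_inv_eq_mul, mul_comm] at h3
    rwa [neg_div]
  have h4 : ν ^ (-(d : ℝ) / 2) * (Real.pi / (c / ν)) ^ ((d : ℝ) / 2) =
      (Real.pi / c) ^ ((d : ℝ) / 2) := by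
    rw [show Real.pi / (c / ν) = Real.pi / c * ν by field_simp,
      Real.mul_rpow (by positivity) hν.le, neg_div, Real.rpow_neg hν.le]
    have : ν ^ ((d : ℝ) / 2) ≠ 0 := by positivity
    field_simp
  calc μ ^ (-(d : ℝ) / 2) * ν ^ (-(d : ℝ) / 2) *
        (Real.exp m * Real.exp (-q) * (Real.pi / (c / ν)) ^ ((d : ℝ) / 2))
      = μ ^ (-(d : ℝ) / 2) * (Real.exp m * Real.exp (-q) *
          (ν ^ (-(d : ℝ) / 2) * (Real.pi / (c / ν)) ^ ((d : ℝ) / 2))) := by ring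
    _ ≤ (2 ^ ((d : ℝ) / 2) * (μ + ν) ^ (-(d : ℝ) / 2)) * (Real.exp m * Real.exp (-q) *
          (Real.pi / c) ^ ((d : ℝ) / 2)) := by rw [h4]; gcongr
    _ = _ := by ring

/-- Gaussian convolution through a bi-Lipschitz map `φ`, with constants depending only on the
bi-Lipschitz constant `K`. -/
lemma integral_gaussk_mul_gaussk_comp_le {d : ℕ} {K l α β : ℝ} (hK : 1 ≤ K) (hl : 0 < l)
    (hα : 0 < α) (hβ : 0 < β) {φ : Vec d → Vec d}
    (hφ : ∀ z w, ‖φ z - φ w‖ ≤ K * ‖z - w‖) (hφ' : ∀ z w, ‖z - w‖ ≤ K * ‖φ z - φ w‖)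
    (a y : Vec d) :
    ∫ z, gaussk d l α (a - z) * gaussk d l β (φ z - y) ≤
      Real.exp (l / 8) * 2 ^ ((d : ℝ) / 2) * (Real.pi / (l / (16 * K ^ 2))) ^ ((d : ℝ) / 2) *
        gaussk d (1 / (2 * K ^ 2) * l) (α + β) (φ a - y) := by
  have hK0 : 0 < K := one_pos.trans_le hK
  set q : ℝ := 1 / (2 * K ^ 2) * l * ‖φ a - y‖ ^ 2 / (α + β) with hq
  have htri : ∀ z, q ≤ l / 2 * (‖a - z‖ ^ 2 / α) + l / 2 * (‖φ z - y‖ ^ 2 / β) := by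
    intro z
    have h1 : ‖φ a - y‖ ≤ K * (‖a - z‖ + ‖φ z - y‖) := by
      have := norm_sub_le_norm_sub_add_norm_sub (φ a) (φ z) y
      have h2 := hφ a z
      nlinarith [norm_nonneg (φ z - y)]
    have h2 : ‖φ a - y‖ ^ 2 / (α + β) ≤ K ^ 2 * (‖a - z‖ ^ 2 / α + ‖φ z - y‖ ^ 2 / β) := by
      calc ‖φ a - y‖ ^ 2 / (α + β) ≤ (K * (‖a - z‖ + ‖φ z - y‖)) ^ 2 / (α + β) := by gcongr
        _ = K ^ 2 * ((‖a - z‖ + ‖φ z - y‖) ^ 2 / (α + β)) := by ring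
        _ ≤ _ := by
          gcongr
          rw [div_add_div _ _ hα.ne' hβ.ne', div_le_div_iff₀ (by positivity) (by positivity)]
          linarith [sq_nonneg (β * ‖a - z‖ - α * ‖φ z - y‖)]
    calc q = l / (2 * K ^ 2) * (‖φ a - y‖ ^ 2 / (α + β)) := by rw [hq]; ring
      _ ≤ l / (2 * K ^ 2) * (K ^ 2 * (‖a - z‖ ^ 2 / α + ‖φ z - y‖ ^ 2 / β)) := by gcongr
      _ = _ := by field_simp
  have hprod : ∀ z, gaussk d l α (a - z) * gaussk d l β (φ z - y) ≤
      α ^ (-(d : ℝ) / 2) * β ^ (-(d : ℝ) / 2) *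
        Real.exp (-q - l / 2 * (‖a - z‖ ^ 2 / α) - l / 2 * (‖φ z - y‖ ^ 2 / β)) := by
    intro z
    have : gaussk d l α (a - z) * gaussk d l β (φ z - y) =
        α ^ (-(d : ℝ) / 2) * β ^ (-(d : ℝ) / 2) *
          Real.exp (-l * ‖a - z‖ ^ 2 / α + -l * ‖φ z - y‖ ^ 2 / β) := by
      rw [Real.exp_add, gaussk, gaussk]; ring
    rw [this]
    gcongr
    have e1 : -l * ‖a - z‖ ^ 2 / α = -(l * (‖a - z‖ ^ 2 / α)) := by ring
    have e2 : -l * ‖φ z - y‖ ^ 2 / β = -(l * (‖φ z - y‖ ^ 2 / β)) := by ring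
    rw [e1, e2]
    linarith [htri z]
  have hnn : ∀ z, 0 ≤ gaussk d l α (a - z) * gaussk d l β (φ z - y) := fun z =>
    mul_nonneg (gaussk_nonneg d l hα.le _) (gaussk_nonneg d l hβ.le _)
  have hrhs : gaussk d (1 / (2 * K ^ 2) * l) (α + β) (φ a - y) =
      (α + β) ^ (-(d : ℝ) / 2) * Real.exp (-q) := by
    rw [gaussk, hq]
    congr 2
    ring
  rw [hrhs]
  rcases le_total α β with hαβ | hβα
  · rw [add_comm α β]
    refine integral_le_of_le_gaussian (by positivity) hα hαβ hnn a fun z => ?_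
    refine (hprod z).trans ?_
    rw [mul_comm (α ^ _), ← Real.exp_add, ← Real.exp_add]
    gcongr
    have h1 : l / (16 * K ^ 2) / α * ‖z - a‖ ^ 2 ≤ l / 2 * (‖a - z‖ ^ 2 / α) := by
      rw [norm_sub_rev z a, div_mul_eq_mul_div, mul_div_assoc]
      gcongr
      nlinarith
    have h2 : 0 ≤ l / 2 * (‖φ z - y‖ ^ 2 / β) := by positivity
    linarith
  · -- a near-minimiser of the distance to `y` replaces the (possibly nonexistent) preimage of `y`
    obtain ⟨z₀, hz₀⟩ : ∃ z₀, ∀ z, ‖φ z₀ - y‖ ≤ ‖φ z - y‖ + √β := by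
      have hlt : (⨅ z, ‖φ z - y‖) < (⨅ z, ‖φ z - y‖) + √β := by
        linarith [Real.sqrt_pos.2 hβ]
      obtain ⟨z₀, hz₀⟩ := exists_lt_of_ciInf_lt hlt
      refine ⟨z₀, fun z => hz₀.le.trans ?_⟩
      gcongr
      exact ciInf_le ⟨0, by rintro _ ⟨w, rfl⟩; exact norm_nonneg _⟩ z
    refine integral_le_of_le_gaussian (by positivity) hβ hβα hnn z₀ fun z => ?_
    refine (hprod z).trans ?_
    rw [← Real.exp_add, ← Real.exp_add]
    gcongr
    have h1 : ‖z - z₀‖ ≤ K * (2 * ‖φ z - y‖ + √β) := by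
      refine (hφ' z z₀).trans ?_
      gcongr
      have := norm_sub_le_norm_sub_add_norm_sub (φ z) y (φ z₀)
      rw [norm_sub_rev y] at this
      linarith [hz₀ z]
    have h2 : ‖z - z₀‖ ^ 2 ≤ K ^ 2 * (8 * ‖φ z - y‖ ^ 2 + 2 * β) := by
      calc ‖z - z₀‖ ^ 2 ≤ (K * (2 * ‖φ z - y‖ + √β)) ^ 2 := by gcongr
        _ = K ^ 2 * (2 * ‖φ z - y‖ + √β) ^ 2 := by ring
        _ ≤ _ := by
          gcongr
          nlinarith [sq_nonneg (2 * ‖φ z - y‖ - √β), Real.sq_sqrt hβ.le]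
    have h3 : l / (16 * K ^ 2) / β * ‖z - z₀‖ ^ 2 ≤ l / 2 * (‖φ z - y‖ ^ 2 / β) + l / 8 := by
      calc l / (16 * K ^ 2) / β * ‖z - z₀‖ ^ 2
          ≤ l / (16 * K ^ 2) / β * (K ^ 2 * (8 * ‖φ z - y‖ ^ 2 + 2 * β)) := by gcongr
        _ = _ := by field_simp; ring
    have h4 : 0 ≤ l / 2 * (‖a - z‖ ^ 2 / α) := by positivity
    linarith

/-- **Flow–Gaussian convolution inequality.** Under (H^b_0), for any `T > 0`
there is `ε = ε(T,κ₁,d) ∈ (0,1)` such that for every `λ > 0` there is `C = C(T,κ₁,d,λ) > 0`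
with `∫ 𝐠_λ(s,x,r,z) 𝐠_λ(r,z,t,y) dz ≤ C 𝐠_{ελ}(s,x,t,y)` for all `(s,t) ∈ 𝔻^T_0`,
`r ∈ (s,t)` and `x,y`, where `𝐠_λ(s,x,t,y) = g_λ(t−s, θ^{(1)}_{t,s}(x) − y)`. -/
theorem flow_gaussian_convolution
    (d : ℕ) (κ₁ : ℝ) (hκ₁ : 0 < κ₁) (T : ℝ) (hT : 0 < T)
    (ρ : Vec d → ℝ) (hρ : IsMollifier d ρ) :
    ∃ ε ∈ Set.Ioo (0 : ℝ) 1, ∀ l : ℝ, 0 < l → ∃ C > (0 : ℝ),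
      ∀ (b : ℝ → Vec d → Vec d) (θ1 : ℝ → ℝ → Vec d → Vec d),
        HolderDrift d b κ₁ 0 → IsFlow d (mollifiedDrift d ρ 1 b) θ1 →
      ∀ s r t : ℝ, 0 ≤ s → s < r → r < t → t - s < T → ∀ x y : Vec d,
        (∫ z : Vec d, gaussk d l (r - s) (θ1 r s x - z) * gaussk d l (t - r) (θ1 t r z - y)) ≤
          C * gaussk d (ε * l) (t - s) (θ1 t s x - y) := by
  obtain ⟨L, hL, hLip⟩ := hρ.exists_lipschitzDrift hκ₁
  set K : ℝ := Real.exp (L * T) with hKdef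
  have hK : 1 ≤ K := Real.one_le_exp (by positivity)
  have hK2 : 1 ≤ K ^ 2 := one_le_pow₀ hK
  refine ⟨1 / (2 * K ^ 2), ⟨by positivity, ?_⟩, fun l hl =>
    ⟨Real.exp (l / 8) * 2 ^ ((d : ℝ) / 2) * (Real.pi / (l / (16 * K ^ 2))) ^ ((d : ℝ) / 2), ?_, ?_⟩⟩
  · rw [div_lt_one (by positivity)]
    linarith
  · have := Real.pi_pos
    positivity
  intro b θ hb hθ s r t hs hsr hrt htT x y
  have hf := hLip b hb
  have hr : 0 ≤ r := hs.trans hsr.le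
  have hexp : Real.exp (L * (t - r)) ≤ K := by
    rw [hKdef]
    gcongr
    linarith
  have hstab := fun z w => (hθ.isForwardSolution hr z).norm_sub_le hL hr hf
    (hθ.isForwardSolution hr w) hrt.le
  have h := integral_gaussk_mul_gaussk_comp_le hK hl (sub_pos.2 hsr) (sub_pos.2 hrt)
    (φ := θ t r)
    (fun z w => by
      rw [mul_comm]
      exact (hstab z w).1.trans (mul_le_mul_of_nonneg_left hexp (norm_nonneg _)))
    (fun z w => by
      rw [mul_comm]
      exact (hstab z w).2.trans (mul_le_mul_of_nonneg_left hexp (norm_nonneg _)))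
    (θ r s x) y
  rwa [hθ.comp_apply hL hf hs hsr.le hrt.le, show r - s + (t - r) = t - s by ring] at h
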